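/- Let a be a random variable with mean zero and unit variance whose distribution has a density p supported in [−b, b], and define p*(y) = E[a·1{a > y}], which is the density of the a-zero-bias distribution. Then ∫_ℝ |p(y) − p*(y)| dy ≤ (1 + b²) ∫_ℝ |p(y) − φ(y)| dy, where φ is the standard normal density. In other words, d_TV(a, a*) ≤ (1 + b²) d_TV(a, g) for g ~ N(0,1), with d_TV denoting the L¹ distance between densities. -/

import Mathlib

open MeasureTheory Real

noncomputable section

lemma hasDerivAt_exp_neg_sq_div_two (x : ℝ) :
    HasDerivAt (fun z : ℝ => Real.exp (-z ^ 2 / 2)) (Real.exp (-x ^ 2 / 2) * -x) x := by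
  have h : HasDerivAt (fun z : ℝ => -z ^ 2 / 2) (-x) x := by
    refine ((hasDerivAt_pow 2 x).neg.div_const 2).congr_deriv ?_
    norm_num
    ring
  exact h.exp

lemma integrable_exp_neg_sq_div_two : Integrable fun z : ℝ => Real.exp (-z ^ 2 / 2) := by
  refine (integrable_exp_neg_mul_sq (b := 1 / 2) (by norm_num)).congr (.of_forall fun z => ?_)
  simp only
  congr 1
  ring

/-- Lower Gaussian tail bound (Mills ratio), for the unnormalised density `exp (-x ^ 2 / 2)`. -/
lemma mul_exp_neg_sq_div_two_le (b : ℝ) :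
    b * Real.exp (-b ^ 2 / 2) ≤ (1 + b ^ 2) * ∫ z in Set.Ioi b, Real.exp (-z ^ 2 / 2) := by
  have hexp := integrable_exp_neg_sq_div_two
  have hderiv : ∀ x : ℝ, HasDerivAt (fun z => -(z / (1 + z ^ 2)) * Real.exp (-z ^ 2 / 2))
      (Real.exp (-x ^ 2 / 2) * (1 - 2 / (1 + x ^ 2) ^ 2)) x := by
    intro x
    have hx : (1 + x ^ 2) ≠ 0 := by positivity
    have h1 : HasDerivAt (fun z : ℝ => 1 + z ^ 2) (2 * x) x := by
      simpa using (hasDerivAt_pow 2 x).const_add 1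
    refine ((((hasDerivAt_id x).div h1 hx).neg).mul (hasDerivAt_exp_neg_sq_div_two x)).congr_deriv ?_
    simp only [id, Pi.neg_apply, Pi.div_apply]
    field_simp
    ring
  have hint : Integrable fun x : ℝ => Real.exp (-x ^ 2 / 2) * (1 - 2 / (1 + x ^ 2) ^ 2) := by
    refine hexp.mono (by fun_prop) (.of_forall fun x => ?_)
    rw [norm_mul]
    refine mul_le_of_le_one_right (norm_nonneg _) ?_
    have h : (2 : ℝ) / (1 + x ^ 2) ^ 2 ≤ 2 := by
      refine div_le_self (by norm_num) ?_
      nlinarith [sq_nonneg x]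
    have h' : (0 : ℝ) ≤ 2 / (1 + x ^ 2) ^ 2 := by positivity
    rw [Real.norm_eq_abs, abs_le]
    constructor <;> linarith
  have hlim : Filter.Tendsto (fun z : ℝ => -(z / (1 + z ^ 2)) * Real.exp (-z ^ 2 / 2))
      Filter.atTop (nhds 0) := by
    have hsq : Filter.Tendsto (fun z : ℝ => Real.exp (-z ^ 2 / 2)) Filter.atTop (nhds 0) := by
      refine Real.tendsto_exp_atBot.comp ?_
      have h : Filter.Tendsto (fun z : ℝ => z ^ 2 / 2) Filter.atTop Filter.atTop :=
        (Filter.tendsto_pow_atTop two_ne_zero).atTop_div_const (by norm_num)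
      refine (Filter.tendsto_neg_atTop_atBot.comp h).congr fun z => ?_
      simp only [Function.comp]
      ring
    refine squeeze_zero_norm (fun z => ?_) hsq
    rw [norm_mul, Real.norm_eq_abs (Real.exp _), abs_of_pos (Real.exp_pos _)]
    refine mul_le_of_le_one_left (Real.exp_pos _).le ?_
    rw [norm_neg, Real.norm_eq_abs, abs_div, abs_of_pos (by positivity : 0 < 1 + z ^ 2),
      div_le_one (by positivity)]
    nlinarith [sq_nonneg (|z| - 1), sq_abs z]
  have key := integral_Ioi_of_hasDerivAt_of_tendsto' (a := b) (fun x _ => hderiv x)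
    hint.integrableOn hlim
  have hle : (∫ x in Set.Ioi b, Real.exp (-x ^ 2 / 2) * (1 - 2 / (1 + x ^ 2) ^ 2)) ≤
      ∫ x in Set.Ioi b, Real.exp (-x ^ 2 / 2) := by
    refine integral_mono hint.integrableOn hexp.integrableOn fun x => ?_
    refine mul_le_of_le_one_right (Real.exp_pos _).le ?_
    have h' : (0 : ℝ) ≤ 2 / (1 + x ^ 2) ^ 2 := by positivity
    linarith
  rw [key] at hle
  have hb : (0 : ℝ) < 1 + b ^ 2 := by positivity
  calc b * Real.exp (-b ^ 2 / 2)
      = (1 + b ^ 2) * (0 - -(b / (1 + b ^ 2)) * Real.exp (-b ^ 2 / 2)) := by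
        field_simp
        ring
    _ ≤ _ := mul_le_mul_of_nonneg_left hle hb.le

/-- Fubini on the triangle `0 < y < z ≤ b`. -/
lemma integral_Ioc_integral_Ioc_eq {b : ℝ} {g : ℝ → ℝ}
    (hg : IntegrableOn g (Set.Ioc 0 b)) :
    IntegrableOn (fun y => ∫ z in Set.Ioc y b, g z) (Set.Ioc 0 b) ∧
    (∫ y in Set.Ioc 0 b, ∫ z in Set.Ioc y b, g z) = ∫ z in Set.Ioc 0 b, z * g z := by
  set μ : Measure ℝ := volume.restrict (Set.Ioc 0 b) with hμ
  have hT : MeasurableSet {x : ℝ × ℝ | x.1 < x.2} := measurableSet_lt measurable_fst measurable_snd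
  have hF : Integrable ({x : ℝ × ℝ | x.1 < x.2}.indicator fun x => g x.2) (μ.prod μ) :=
    Integrable.indicator (Integrable.comp_snd hg μ) hT
  have hinner : ∀ y ∈ Set.Ioc 0 b, (∫ z in Set.Ioc y b, g z) =
      ∫ z, {x : ℝ × ℝ | x.1 < x.2}.indicator (fun x => g x.2) (y, z) ∂μ := by
    intro y hy
    have : ∀ z, {x : ℝ × ℝ | x.1 < x.2}.indicator (fun x => g x.2) (y, z) =
        (Set.Ioi y).indicator g z := fun z => by
      simp [Set.indicator]
    simp_rw [this]
    rw [integral_indicator measurableSet_Ioi, hμ, Measure.restrict_restrict measurableSet_Ioi]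
    congr 2
    ext z
    simp only [Set.mem_Ioc, Set.mem_inter_iff, Set.mem_Ioi]
    have := hy.1
    grind
  have houter : ∀ z ∈ Set.Ioc 0 b, z * g z =
      ∫ y, {x : ℝ × ℝ | x.1 < x.2}.indicator (fun x => g x.2) (y, z) ∂μ := by
    intro z hz
    have : ∀ y, {x : ℝ × ℝ | x.1 < x.2}.indicator (fun x => g x.2) (y, z) =
        (Set.Iio z).indicator (fun _ => g z) y := fun y => by
      simp [Set.indicator]
    simp_rw [this]
    rw [integral_indicator measurableSet_Iio, hμ, Measure.restrict_restrict measurableSet_Iio,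
      show Set.Iio z ∩ Set.Ioc 0 b = Set.Ioo 0 z by
        ext y
        have := hz.2
        simp only [Set.mem_Ioc, Set.mem_inter_iff, Set.mem_Iio, Set.mem_Ioo]
        grind]
    simp [hz.1.le]
  constructor
  · refine hF.integral_prod_left.congr ?_
    filter_upwards [ae_restrict_mem measurableSet_Ioc] with y hy using (hinner y hy).symm
  · rw [setIntegral_congr_fun measurableSet_Ioc hinner,
      setIntegral_congr_fun measurableSet_Ioc houter]
    exact integral_integral_swap hF

/-- The bound on the positive half-line. -/
lemma setIntegral_Ioi_abs_sub_zeroBias_le {b : ℝ} (hb : 0 ≤ b) {p : ℝ → ℝ}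
    (hp_int : Integrable p) (hp_supp : ∀ y, b < y → p y = 0) :
    (∫ y in Set.Ioi 0, |p y - ∫ z in Set.Ioi y, z * p z|) ≤
      (1 + b ^ 2) *
        ∫ y in Set.Ioi 0, |p y - Real.exp (-y ^ 2 / 2) / Real.sqrt (2 * π)| := by
  set f : ℝ → ℝ := fun y => Real.exp (-y ^ 2 / 2) / Real.sqrt (2 * π) with hf
  have hs : 0 < Real.sqrt (2 * π) := by positivity
  have hf_pos : ∀ y, 0 < f y := fun y => by positivity
  have hf_cont : Continuous f := by fun_prop
  have hf_int : Integrable f := integrable_exp_neg_sq_div_two.div_const _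
  have hq_int : Integrable fun y => |p y - f y| := (hp_int.sub hf_int).abs
  have hbdd : ∀ {g : ℝ → ℝ}, Integrable g → IntegrableOn (fun z => z * g z) (Set.Ioc 0 b) := by
    intro g hg
    refine Integrable.bdd_mul (c := b) hg.integrableOn (by fun_prop) ?_
    filter_upwards [ae_restrict_mem measurableSet_Ioc] with z hz
    rw [Real.norm_eq_abs, abs_of_pos hz.1]
    exact hz.2
  have hFTC : ∀ y, y ≤ b → (∫ z in Set.Ioc y b, z * f z) = f y - f b := by
    intro y hy
    have hd : ∀ x ∈ Set.uIcc y b, HasDerivAt (fun z => -f z) (x * f x) x := by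
      intro x _
      refine (((hasDerivAt_exp_neg_sq_div_two x).div_const (Real.sqrt (2 * π))).neg).congr_deriv ?_
      simp only [hf]
      ring
    rw [← intervalIntegral.integral_of_le hy, intervalIntegral.integral_eq_sub_of_hasDerivAt hd
      ((continuous_id.mul hf_cont).intervalIntegrable _ _)]
    ring
  have hsub : ∀ y, 0 < y → Set.Ioc y b ⊆ Set.Ioc 0 b := fun y hy => Set.Ioc_subset_Ioc_left hy.le
  have hstar : ∀ y, (∫ z in Set.Ioi y, z * p z) = ∫ z in Set.Ioc y b, z * p z := by
    intro y
    refine setIntegral_eq_of_subset_of_forall_sdiff_eq_zero measurableSet_Ioi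
      Set.Ioc_subset_Ioi_self fun z hz => ?_
    rw [hp_supp z (by simp only [Set.mem_sdiff, Set.mem_Ioi, Set.mem_Ioc] at hz; grind), mul_zero]
  have hpt : ∀ y ∈ Set.Ioc 0 b, |p y - ∫ z in Set.Ioi y, z * p z| ≤
      |p y - f y| + ((∫ z in Set.Ioc y b, z * |p z - f z|) + f b) := by
    intro y hy
    have h1 : (∫ z in Set.Ioc y b, z * (p z - f z)) =
        (∫ z in Set.Ioi y, z * p z) - (f y - f b) := by
      rw [hstar, ← hFTC y hy.2, ← integral_sub ((hbdd hp_int).mono_set (hsub y hy.1))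
        ((hbdd hf_int).mono_set (hsub y hy.1))]
      simp_rw [mul_sub]
    have h2 : |∫ z in Set.Ioc y b, z * (p z - f z)| ≤ ∫ z in Set.Ioc y b, z * |p z - f z| := by
      refine abs_integral_le_integral_abs.trans_eq (setIntegral_congr_fun measurableSet_Ioc ?_)
      intro z hz
      simp only [abs_mul, abs_of_pos (hy.1.trans hz.1)]
    rw [h1] at h2
    have h3 := hf_pos b
    have e : p y - (∫ z in Set.Ioi y, z * p z) =
      (p y - f y) - ((∫ z in Set.Ioi y, z * p z) - (f y - f b)) + f b := by ring
    rw [e]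
    calc _ ≤ |p y - f y - ((∫ z in Set.Ioi y, z * p z) - (f y - f b))| + |f b| := abs_add_le _ _
      _ ≤ |p y - f y| + |(∫ z in Set.Ioi y, z * p z) - (f y - f b)| + |f b| := by
        gcongr
        exact abs_sub _ _
      _ ≤ _ := by rw [abs_of_pos h3]; linarith
  obtain ⟨hI, hE⟩ := integral_Ioc_integral_Ioc_eq (hbdd hq_int)
  have hzz : IntegrableOn (fun z => z * (z * |p z - f z|)) (Set.Ioc 0 b) := by
    refine Integrable.bdd_mul (c := b) (hbdd hq_int) (by fun_prop) ?_
    filter_upwards [ae_restrict_mem measurableSet_Ioc] with z hz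
    rw [Real.norm_eq_abs, abs_of_pos hz.1]
    exact hz.2
  have hc : IntegrableOn (fun _ : ℝ => f b) (Set.Ioc 0 b) := by simp
  have hIc : IntegrableOn (fun y => (∫ z in Set.Ioc y b, z * |p z - f z|) + f b) (Set.Ioc 0 b) :=
    hI.add hc
  have hinside : (∫ y in Set.Ioc 0 b, |p y - ∫ z in Set.Ioi y, z * p z|) ≤
      (1 + b ^ 2) * (∫ y in Set.Ioc 0 b, |p y - f y|) + b * f b := by
    calc _ ≤ ∫ y in Set.Ioc 0 b, (|p y - f y| + ((∫ z in Set.Ioc y b, z * |p z - f z|) + f b)) := by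
          refine integral_mono_of_nonneg (.of_forall fun _ => abs_nonneg _)
            (hq_int.integrableOn.add hIc) ?_
          filter_upwards [ae_restrict_mem measurableSet_Ioc] with y hy using hpt y hy
      _ = (∫ y in Set.Ioc 0 b, |p y - f y|) +
          ((∫ z in Set.Ioc 0 b, z * (z * |p z - f z|)) + b * f b) := by
          rw [integral_add hq_int.integrableOn hIc, integral_add hI hc, hE]
          simp [hb]
      _ ≤ (∫ y in Set.Ioc 0 b, |p y - f y|) +
          (b ^ 2 * (∫ z in Set.Ioc 0 b, |p z - f z|) + b * f b) := by
          gcongr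
          rw [← integral_const_mul]
          refine setIntegral_mono_on hzz (hq_int.integrableOn.const_mul _) measurableSet_Ioc ?_
          intro z hz
          rw [← mul_assoc, ← pow_two]
          have := pow_le_pow_left₀ hz.1.le hz.2 2
          gcongr
      _ = _ := by ring
  have hlhs : (∫ y in Set.Ioi 0, |p y - ∫ z in Set.Ioi y, z * p z|) =
      ∫ y in Set.Ioc 0 b, |p y - ∫ z in Set.Ioi y, z * p z| := by
    refine setIntegral_eq_of_subset_of_forall_sdiff_eq_zero measurableSet_Ioi
      Set.Ioc_subset_Ioi_self fun y hy => ?_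
    have hyb : b < y := by simp only [Set.mem_sdiff, Set.mem_Ioi, Set.mem_Ioc] at hy; grind
    rw [hstar, hp_supp y hyb, Set.Ioc_eq_empty_of_le hyb.le]
    simp
  have hsplit : (∫ y in Set.Ioi 0, |p y - f y|) =
      (∫ y in Set.Ioc 0 b, |p y - f y|) + ∫ y in Set.Ioi b, f y := by
    rw [← Set.Ioc_union_Ioi_eq_Ioi hb, setIntegral_union (Set.Ioc_disjoint_Ioi le_rfl)
      measurableSet_Ioi hq_int.integrableOn hq_int.integrableOn]
    congr 1
    refine setIntegral_congr_fun measurableSet_Ioi fun y hy => ?_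
    simp [hp_supp y hy, abs_of_pos (hf_pos y)]
  have hmills : b * f b ≤ (1 + b ^ 2) * ∫ y in Set.Ioi b, f y := by
    simp only [hf]
    rw [integral_div, ← mul_div_assoc, ← mul_div_assoc]
    exact div_le_div_of_nonneg_right (mul_exp_neg_sq_div_two_le b) hs.le
  rw [hlhs, hsplit]
  linarith

/-- Let `a` be a random variable with mean zero and unit variance whose
distribution has a density `p` supported in `[-b, b]`, and let
`p*(y) = E[a·1{a > y}] = ∫_{z > y} z p(z) dz` be the density of the `a`-zero-bias
distribution.  Then `∫ |p - p*| ≤ (1 + b²) ∫ |p - φ|` where `φ` is the standard normal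
density, i.e. `d_TV(a, a*) ≤ (1 + b²) d_TV(a, g)`. -/
theorem stmt_15 (b : ℝ) (p : ℝ → ℝ)
    (hp_meas : Measurable p)
    (hp_nonneg : ∀ y, 0 ≤ p y)
    (hp_int : Integrable p)
    (hp_mass : (∫ y, p y) = 1)
    (hp_mean : (∫ y, y * p y) = 0)
    (hp_var : (∫ y, y ^ 2 * p y) = 1)
    (hp_supp : ∀ y, y ∉ Set.Icc (-b) b → p y = 0) :
    (∫ y, |p y - ∫ z in Set.Ioi y, z * p z|) ≤
      (1 + b ^ 2) * ∫ y, |p y - Real.exp (-y ^ 2 / 2) / Real.sqrt (2 * π)| := by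
  have hb : 0 ≤ b := by
    by_contra! h
    have : p = 0 := funext fun y => hp_supp y (by
      simp only [Set.mem_Icc]
      grind)
    simp [this] at hp_mass
  set f : ℝ → ℝ := fun y => Real.exp (-y ^ 2 / 2) / Real.sqrt (2 * π) with hf
  have hf_int : Integrable f := integrable_exp_neg_sq_div_two.div_const _
  have hq_int : Integrable fun y => |p y - f y| := (hp_int.sub hf_int).abs
  by_cases hL : Integrable fun y => |p y - ∫ z in Set.Ioi y, z * p z|
  swap
  · rw [integral_undef hL]
    positivity
  have hzp : Integrable fun z => z * p z := by
    refine (hp_int.const_mul b).mono (by fun_prop) (.of_forall fun z => ?_)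
    by_cases hz : z ∈ Set.Icc (-b) b
    · rw [norm_mul, norm_mul, Real.norm_eq_abs, Real.norm_eq_abs b, abs_of_nonneg hb]
      exact mul_le_mul_of_nonneg_right (abs_le.2 hz) (norm_nonneg _)
    · simp [hp_supp z hz]
  have hpos := setIntegral_Ioi_abs_sub_zeroBias_le hb hp_int
    (fun y hy => hp_supp y fun h => absurd h.2 hy.not_ge)
  have hneg := setIntegral_Ioi_abs_sub_zeroBias_le hb hp_int.comp_neg
    (fun y hy => hp_supp (-y) fun h => absurd h.1 (by linarith))
  have hrefl : ∀ y, (∫ z in Set.Ioi y, z * p (-z)) = ∫ z in Set.Ioi (-y), z * p z := by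
    intro y
    have h1 : (∫ z in Set.Ioi y, z * p (-z)) = -∫ z in Set.Iic (-y), z * p z := by
      rw [← integral_comp_neg_Ioi, ← integral_neg]
      simp
    have h2 := intervalIntegral.integral_Iic_add_Ioi (b := -y) hzp.integrableOn hzp.integrableOn
    rw [hp_mean] at h2
    linarith
  have e1 : (∫ y in Set.Ioi 0, |p (-y) - ∫ z in Set.Ioi y, z * p (-z)|) =
      ∫ y in Set.Iic 0, |p y - ∫ z in Set.Ioi y, z * p z| := by
    simp_rw [hrefl]
    rw [integral_comp_neg_Ioi 0 fun y => |p y - ∫ z in Set.Ioi y, z * p z|, neg_zero]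
  have e2 : (∫ y in Set.Ioi 0, |p (-y) - Real.exp (-y ^ 2 / 2) / Real.sqrt (2 * π)|) =
      ∫ y in Set.Iic 0, |p y - f y| := by
    have h := integral_comp_neg_Ioi 0 fun y => |p y - f y|
    rw [neg_zero] at h
    rw [← h]
    simp only [hf, neg_sq]
  rw [e1, e2] at hneg
  rw [← intervalIntegral.integral_Iic_add_Ioi (b := 0) hL.integrableOn hL.integrableOn,
    ← intervalIntegral.integral_Iic_add_Ioi (b := 0) hq_int.integrableOn hq_int.integrableOn,
    mul_add]
  exact add_le_add hneg hpos
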